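/- Let n > m ≥ 2 be integers and A ⊆ {0,1,…,n−1} × {0,1,…,m−1} a non-empty set. Then the Assouad dimension of the Bedford–McMullen carpet S(A) is at most log_m(s) + log_n(t). -/

import Mathlib

open Set Metric Filter

/-- The Assouad dimension of a set `E` in a metric space: the infimum of all `α ≥ 0`
for which there is `C > 0` such that for every `x ∈ E` and all radii `0 < r ≤ R`,
the set `E ∩ B(x, R)` can be covered by at most `C · (R / r) ^ α` balls of radius `r`. -/
noncomputable def assouadDim {X : Type*} [PseudoMetricSpace X] (E : Set X) : ℝ :=
  sInf { α : ℝ | 0 ≤ α ∧ ∃ C : ℝ, 0 < C ∧ ∀ x ∈ E, ∀ r R : ℝ, 0 < r → r ≤ R →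
    ∃ F : Finset X, (F.card : ℝ) ≤ C * (R / r) ^ α ∧
      E ∩ Metric.ball x R ⊆ ⋃ y ∈ F, Metric.ball y r }

/-- The Bedford–McMullen carpet `S(A)` determined by integers `n, m` and
`A ⊆ {0,…,n−1} × {0,…,m−1}`, as a subset of the Euclidean plane. -/
def bmCarpet (n m : ℕ) (A : Finset (ℕ × ℕ)) : Set (EuclideanSpace ℝ (Fin 2)) :=
  { z | ∃ x y : ℕ → ℕ, (∀ i, (x i, y i) ∈ A) ∧
      z 0 = ∑' i : ℕ, (x i : ℝ) / (n : ℝ) ^ (i + 1) ∧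
      z 1 = ∑' i : ℕ, (y i : ℝ) / (m : ℝ) ^ (i + 1) }

/-- `t_j`: the number of elements `(i, j)` of `A` in row `j`. -/
def rowCount (A : Finset (ℕ × ℕ)) (j : ℕ) : ℕ := (A.filter (fun p => p.2 = j)).card

/-- `s`: the number of non-empty rows. -/
def sVal (m : ℕ) (A : Finset (ℕ × ℕ)) : ℕ :=
  ((Finset.range m).filter (fun j => rowCount A j ≠ 0)).card

/-- `t`: the maximal number of entries in a row. -/
def tVal (m : ℕ) (A : Finset (ℕ × ℕ)) : ℕ :=
  (Finset.range m).sup (fun j => rowCount A j)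

/-- The real number `0.x₀x₁x₂…` in base `b`. -/
noncomputable def digitValue (b : ℕ) (x : ℕ → ℕ) : ℝ :=
  ∑' i : ℕ, (x i : ℝ) / (b : ℝ) ^ (i + 1)

/-- The integer with base-`b` digits `x₀ x₁ … x_{k-1}`. -/
def digitPrefix (b : ℕ) (x : ℕ → ℕ) : ℕ → ℕ
  | 0 => 0
  | k + 1 => b * digitPrefix b x k + x k

theorem hasSum_const_digits {b : ℕ} (hb : 2 ≤ b) :
    HasSum (fun i : ℕ => ((b : ℝ) - 1) / (b : ℝ) ^ (i + 1)) 1 := by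
  have hb' : (2 : ℝ) ≤ b := by exact_mod_cast hb
  have h := (hasSum_geometric_of_lt_one (r := (b : ℝ)⁻¹) (by positivity)
    (inv_lt_one_of_one_lt₀ (by linarith))).mul_left (((b : ℝ) - 1) / b)
  have h1 : (b : ℝ) - 1 ≠ 0 := by linarith
  have hsum : ((b : ℝ) - 1) / b * (1 - (b : ℝ)⁻¹)⁻¹ = 1 := by
    field_simp
  rw [hsum] at h
  refine h.congr_fun fun i => ?_
  rw [pow_succ, inv_pow]
  field_simp

theorem digit_term_le {b : ℕ} {x : ℕ → ℕ} (hx : ∀ i, x i < b) (i : ℕ) :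
    (x i : ℝ) / (b : ℝ) ^ (i + 1) ≤ ((b : ℝ) - 1) / (b : ℝ) ^ (i + 1) := by
  have : (x i : ℝ) + 1 ≤ b := by exact_mod_cast hx i
  gcongr
  linarith

theorem summable_digits {b : ℕ} (hb : 2 ≤ b) {x : ℕ → ℕ} (hx : ∀ i, x i < b) :
    Summable (fun i : ℕ => (x i : ℝ) / (b : ℝ) ^ (i + 1)) :=
  (hasSum_const_digits hb).summable.of_nonneg_of_le (fun _ => by positivity) (digit_term_le hx)

theorem digitValue_nonneg (b : ℕ) (x : ℕ → ℕ) : 0 ≤ digitValue b x :=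
  tsum_nonneg fun _ => by positivity

theorem digitValue_le_one {b : ℕ} (hb : 2 ≤ b) {x : ℕ → ℕ} (hx : ∀ i, x i < b) :
    digitValue b x ≤ 1 := by
  rw [← (hasSum_const_digits hb).tsum_eq]
  exact (summable_digits hb hx).tsum_le_tsum (digit_term_le hx) (hasSum_const_digits hb).summable

theorem mul_digitValue {b : ℕ} (hb : 2 ≤ b) {x : ℕ → ℕ} (hx : ∀ i, x i < b) :
    (b : ℝ) * digitValue b x = x 0 + digitValue b (fun i => x (i + 1)) := by
  have hb' : (b : ℝ) ≠ 0 := by positivity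
  unfold digitValue
  rw [(summable_digits hb hx).tsum_eq_zero_add, mul_add, ← tsum_mul_left]
  congr 1
  · simp [mul_div_cancel₀ _ hb']
  · refine tsum_congr fun i => ?_
    rw [pow_succ _ (i + 1)]
    field_simp

theorem pow_mul_digitValue {b : ℕ} (hb : 2 ≤ b) {x : ℕ → ℕ} (hx : ∀ i, x i < b) (k : ℕ) :
    (b : ℝ) ^ k * digitValue b x = digitPrefix b x k + digitValue b (fun i => x (i + k)) := by
  induction k with
  | zero => simp [digitPrefix]
  | succ k ih =>
    rw [pow_succ', mul_assoc, ih, mul_add, mul_digitValue hb fun i => hx (i + k)]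
    simp only [digitPrefix, zero_add, Nat.cast_add, Nat.cast_mul]
    rw [← add_assoc]
    congr 3
    ext i
    congr 1
    ring

theorem digitPrefix_inj {b : ℕ} {x x' : ℕ → ℕ} (hx : ∀ i, x i < b)
    (hx' : ∀ i, x' i < b) {k : ℕ} (h : digitPrefix b x k = digitPrefix b x' k) :
    ∀ i < k, x i = x' i := by
  induction k with
  | zero => simp
  | succ k ih =>
    simp only [digitPrefix] at h
    have hlast : x k = x' k := by
      have := congrArg (· % b) h
      simpa [Nat.mul_add_mod, Nat.mod_eq_of_lt (hx k), Nat.mod_eq_of_lt (hx' k)] using this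
    have hb : 0 < b := (Nat.zero_le _).trans_lt (hx 0)
    have hinit : digitPrefix b x k = digitPrefix b x' k := by
      rw [hlast] at h
      exact Nat.eq_of_mul_eq_mul_left hb (Nat.add_right_cancel h)
    intro i hi
    rcases Nat.lt_succ_iff_lt_or_eq.mp hi with hi | rfl
    exacts [ih hinit i hi, hlast]

theorem digitPrefix_congr {b : ℕ} {x x' : ℕ → ℕ} {k : ℕ} (h : ∀ i < k, x i = x' i) :
    digitPrefix b x k = digitPrefix b x' k := by
  induction k with
  | zero => rfl
  | succ k ih => rw [digitPrefix, digitPrefix, ih fun i hi => h i (by omega), h k (by omega)]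

theorem abs_digitValue_sub_le {b : ℕ} (hb : 2 ≤ b) {x x' : ℕ → ℕ} (hx : ∀ i, x i < b)
    (hx' : ∀ i, x' i < b) {k : ℕ} (h : ∀ i < k, x i = x' i) :
    (b : ℝ) ^ k * |digitValue b x - digitValue b x'| ≤ 1 := by
  rw [← abs_of_nonneg (by positivity : (0 : ℝ) ≤ (b : ℝ) ^ k), ← abs_mul, mul_sub,
    pow_mul_digitValue hb hx, pow_mul_digitValue hb hx', digitPrefix_congr h,
    add_sub_add_left_eq_sub, abs_le]
  have h1 := digitValue_nonneg b fun i => x (i + k)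
  have h2 := digitValue_nonneg b fun i => x' (i + k)
  have h3 := digitValue_le_one hb fun i => hx (i + k)
  have h4 := digitValue_le_one hb fun i => hx' (i + k)
  constructor <;> linarith

theorem abs_digitPrefix_sub_le {b : ℕ} (hb : 2 ≤ b) {x x' : ℕ → ℕ} (hx : ∀ i, x i < b)
    (hx' : ∀ i, x' i < b) (k : ℕ) :
    |(digitPrefix b x' k : ℝ) - digitPrefix b x k| ≤
      (b : ℝ) ^ k * |digitValue b x' - digitValue b x| + 1 := by
  rw [← abs_of_nonneg (by positivity : (0 : ℝ) ≤ (b : ℝ) ^ k), ← abs_mul, mul_sub]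
  have h1 := digitValue_nonneg b fun i => x (i + k)
  have h2 := digitValue_nonneg b fun i => x' (i + k)
  have h3 := digitValue_le_one hb fun i => hx (i + k)
  have h4 := digitValue_le_one hb fun i => hx' (i + k)
  have h5 := pow_mul_digitValue hb hx k
  have h6 := pow_mul_digitValue hb hx' k
  have h7 := le_abs_self ((b : ℝ) ^ k * digitValue b x' - (b : ℝ) ^ k * digitValue b x)
  have h8 := neg_abs_le ((b : ℝ) ^ k * digitValue b x' - (b : ℝ) ^ k * digitValue b x)
  rw [abs_le]
  constructor <;> linarith

/-- The least `k` with `b ^ (-k) ≤ ρ / 2`. -/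
noncomputable def digitLevel (b : ℕ) (ρ : ℝ) : ℕ := sInf {k : ℕ | 2 / ρ ≤ (b : ℝ) ^ k}

theorem two_div_le_pow_digitLevel {b : ℕ} (hb : 2 ≤ b) (ρ : ℝ) :
    2 / ρ ≤ (b : ℝ) ^ digitLevel b ρ := by
  have hne : {k : ℕ | 2 / ρ ≤ (b : ℝ) ^ k}.Nonempty := by
    obtain ⟨k, hk⟩ := pow_unbounded_of_one_lt (2 / ρ) (by exact_mod_cast hb : (1 : ℝ) < b)
    exact ⟨k, hk.le⟩
  exact Nat.sInf_mem hne

theorem digitLevel_le {b : ℕ} {ρ : ℝ} {k : ℕ} (h : 2 / ρ ≤ (b : ℝ) ^ k) : digitLevel b ρ ≤ k :=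
  Nat.sInf_le h

theorem pow_digitLevel_mul_le {b : ℕ} {ρ : ℝ} (hρ : 0 < ρ)
    (h : digitLevel b ρ ≠ 0) : (b : ℝ) ^ digitLevel b ρ * ρ ≤ 2 * b := by
  obtain ⟨k, hk⟩ := Nat.exists_eq_succ_of_ne_zero h
  have hlt : (b : ℝ) ^ k < 2 / ρ := by
    by_contra! hle
    have := digitLevel_le hle
    omega
  rw [lt_div_iff₀ hρ] at hlt
  rw [hk, pow_succ]
  have := mul_le_mul_of_nonneg_right hlt.le (Nat.cast_nonneg (α := ℝ) b)
  linarith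

theorem digitLevel_anti {b : ℕ} (hb : 2 ≤ b) {r R : ℝ} (hr : 0 < r) (hrR : r ≤ R) :
    digitLevel b R ≤ digitLevel b r := by
  refine digitLevel_le (le_trans ?_ (two_div_le_pow_digitLevel hb r))
  gcongr

theorem digitLevel_le_of_base_le {m n : ℕ} (hm : 2 ≤ m) (hmn : m ≤ n) (ρ : ℝ) :
    digitLevel n ρ ≤ digitLevel m ρ := by
  refine digitLevel_le (le_trans (two_div_le_pow_digitLevel hm ρ) ?_)
  gcongr

theorem pow_digitLevel_sub_le {b : ℕ} (hb : 2 ≤ b) {r R : ℝ} (hr : 0 < r) (hrR : r ≤ R) :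
    (b : ℝ) ^ (digitLevel b r - digitLevel b R) ≤ b * (R / r) := by
  have hR : 0 < R := hr.trans_le hrR
  have hb' : (1 : ℝ) ≤ b := by exact_mod_cast (by omega : 1 ≤ b)
  by_cases h : digitLevel b r = 0
  · have : 1 ≤ R / r := (one_le_div hr).2 hrR
    simpa [h] using one_le_mul_of_one_le_of_one_le hb' this
  · have h1 := pow_digitLevel_mul_le hr h
    have h2 := two_div_le_pow_digitLevel hb R
    rw [div_le_iff₀ hR] at h2
    have h3 : (b : ℝ) ^ digitLevel b r =
        (b : ℝ) ^ (digitLevel b r - digitLevel b R) * (b : ℝ) ^ digitLevel b R := by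
      rw [← pow_add, Nat.sub_add_cancel (digitLevel_anti hb hr hrR)]
    rw [h3] at h1
    rw [← mul_div_assoc, le_div_iff₀ hr]
    have hp : 0 ≤ (b : ℝ) ^ (digitLevel b r - digitLevel b R) * r := by positivity
    have h4 := mul_le_mul_of_nonneg_left h2 hp
    have h5 := mul_le_mul_of_nonneg_right h1 hR.le
    linarith

theorem digitPrefix_eq_of_mod_eq {b : ℕ} (hb : 2 ≤ b) {x x' : ℕ → ℕ} (hx : ∀ i, x i < b)
    (hx' : ∀ i, x' i < b) {R : ℝ} (hR : 0 < R)
    (hd : |digitValue b x' - digitValue b x| < 2 * R)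
    (h : digitPrefix b x (digitLevel b R) % (4 * b + 2) =
      digitPrefix b x' (digitLevel b R) % (4 * b + 2)) :
    digitPrefix b x (digitLevel b R) = digitPrefix b x' (digitLevel b R) := by
  by_cases h0 : digitLevel b R = 0
  · simp [h0, digitPrefix]
  refine Nat.ModEq.eq_of_abs_lt h ?_
  have h1 := abs_digitPrefix_sub_le hb hx hx' (digitLevel b R)
  have h2 := pow_digitLevel_mul_le hR h0
  have h3 := mul_le_mul_of_nonneg_left hd.le
    (by positivity : (0 : ℝ) ≤ (b : ℝ) ^ digitLevel b R)
  have h4 : |(digitPrefix b x' (digitLevel b R) : ℝ) - digitPrefix b x (digitLevel b R)|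
      < 4 * b + 2 := by linarith
  exact_mod_cast h4

theorem pow_le_rpow_logb {b k s : ℕ} (hb : 2 ≤ b) (hs : 1 ≤ s) {q : ℝ} (hq : (b : ℝ) ^ k ≤ q) :
    (s : ℝ) ^ k ≤ q ^ Real.logb b s := by
  have hb' : (1 : ℝ) < b := by exact_mod_cast hb
  have hs' : (1 : ℝ) ≤ s := by exact_mod_cast hs
  calc (s : ℝ) ^ k = ((b : ℝ) ^ k) ^ Real.logb b s := by
        rw [← Real.rpow_natCast_mul (by positivity), mul_comm, Real.rpow_mul_natCast (by positivity),
          Real.rpow_logb (by positivity) hb'.ne' (by positivity)]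
    _ ≤ q ^ Real.logb b s :=
        Real.rpow_le_rpow (by positivity) hq (Real.logb_nonneg hb' hs')

theorem exists_injOn_fin {α : Type*} (S : Finset α) {k : ℕ} (hk : 0 < k) (hS : S.card ≤ k) :
    ∃ f : α → Fin k, Set.InjOn f S := by
  classical
  have : Nonempty (S ↪ Fin k) :=
    Function.Embedding.nonempty_of_card_le (by simpa using hS)
  obtain ⟨e⟩ := this
  refine ⟨fun a => if h : a ∈ S then e ⟨a, h⟩ else ⟨0, hk⟩, fun a ha a' ha' h => ?_⟩
  have ha := Finset.mem_coe.1 ha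
  have ha' := Finset.mem_coe.1 ha'
  simp only [ha, ha', dite_true] at h
  simpa using e.injective h

/-- A set whose points carry labels in a finite type, points with equal labels being at
distance `< r`, is covered by as many `r`-balls as there are labels. -/
theorem exists_cover_of_label {X T : Type*} [PseudoMetricSpace X] [Fintype T] {E : Set X}
    {r : ℝ} (f : X → T) (hf : ∀ z ∈ E, ∀ z' ∈ E, f z = f z' → dist z z' < r) :
    ∃ F : Finset X, F.card ≤ Fintype.card T ∧ E ⊆ ⋃ y ∈ F, Metric.ball y r := by
  classical
  rcases E.eq_empty_or_nonempty with rfl | ⟨z₀, -⟩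
  · exact ⟨∅, by simp, by simp⟩
  have hg : ∀ c : T, ∃ y : X, (∃ z ∈ E, f z = c) → y ∈ E ∧ f y = c := fun c => by
    by_cases h : ∃ z ∈ E, f z = c
    · obtain ⟨z, hz⟩ := h
      exact ⟨z, fun _ => hz⟩
    · exact ⟨z₀, fun h' => absurd h' h⟩
  choose g hg using hg
  refine ⟨Finset.univ.image g, Finset.card_image_le, fun z hz => ?_⟩
  obtain ⟨h1, h2⟩ := hg (f z) ⟨z, hz, rfl⟩
  simp only [Finset.mem_image, Finset.mem_univ, true_and, Set.mem_iUnion, Metric.mem_ball]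
  exact ⟨_, ⟨_, rfl⟩, hf z hz _ h1 h2.symm⟩

theorem abs_coord_sub_le_dist (z z' : EuclideanSpace ℝ (Fin 2)) (i : Fin 2) :
    |z i - z' i| ≤ dist z z' := by
  simpa [dist_eq_norm] using PiLp.norm_apply_le (z - z') i

theorem dist_lt_of_abs_coord_le {z z' : EuclideanSpace ℝ (Fin 2)} {r : ℝ} (hr : 0 < r)
    (h : ∀ i, |z i - z' i| ≤ r / 2) : dist z z' < r := by
  rw [EuclideanSpace.dist_eq, Real.sqrt_lt' hr, Fin.sum_univ_two, Real.dist_eq, Real.dist_eq]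
  have h0 := pow_le_pow_left₀ (abs_nonneg _) (h 0) 2
  have h1 := pow_le_pow_left₀ (abs_nonneg _) (h 1) 2
  nlinarith [sq_pos_of_pos hr]

theorem abs_digitValue_sub_le_half {b : ℕ} (hb : 2 ≤ b) {x x' : ℕ → ℕ} (hx : ∀ i, x i < b)
    (hx' : ∀ i, x' i < b) {r : ℝ} (hr : 0 < r) (h : ∀ i < digitLevel b r, x i = x' i) :
    |digitValue b x - digitValue b x'| ≤ r / 2 := by
  have h1 := abs_digitValue_sub_le hb hx hx' h
  have h2 := mul_le_mul_of_nonneg_right (two_div_le_pow_digitLevel hb r)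
    (abs_nonneg (digitValue b x - digitValue b x'))
  have h3 := h2.trans h1
  rw [div_mul_eq_mul_div, div_le_iff₀ hr] at h3
  linarith

theorem one_le_rowCount {A : Finset (ℕ × ℕ)} {p : ℕ × ℕ} (hp : p ∈ A) : 1 ≤ rowCount A p.2 :=
  Finset.card_pos.2 ⟨p, by simp [hp]⟩

theorem rowCount_le_tVal {m : ℕ} {A : Finset (ℕ × ℕ)} {j : ℕ} (hj : j < m) :
    rowCount A j ≤ tVal m A :=
  Finset.le_sup (f := fun j => rowCount A j) (Finset.mem_range.2 hj)

/-- The part of the carpet in a ball of radius `R` is covered by boundedly many times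
`s ^ (K(r) - K(R)) * t ^ (L(r) - L(R))` balls of radius `r`, where `K` and `L` are the
digit levels in the bases `m` and `n`. -/
theorem bmCarpet_exists_cover {n m : ℕ} (hm : 2 ≤ m) (hmn : m < n)
    {A : Finset (ℕ × ℕ)} (hAsub : ∀ p ∈ A, p.1 < n ∧ p.2 < m)
    {w : EuclideanSpace ℝ (Fin 2)} {r R : ℝ} (hr : 0 < r) (hrR : r ≤ R)
    (hs : 1 ≤ sVal m A) (ht : 1 ≤ tVal m A) :
    ∃ F : Finset (EuclideanSpace ℝ (Fin 2)),
      F.card ≤ (4 * n + 2) * (4 * m + 2) * (sVal m A ^ (digitLevel m r - digitLevel m R) *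
        tVal m A ^ (digitLevel n r - digitLevel n R)) ∧
      bmCarpet n m A ∩ Metric.ball w R ⊆ ⋃ y ∈ F, Metric.ball y r := by
  have hn : 2 ≤ n := by omega
  have hR : 0 < R := hr.trans_le hrR
  obtain ⟨rowLabel, hrow⟩ := exists_injOn_fin
    ((Finset.range m).filter (fun j => rowCount A j ≠ 0)) (k := sVal m A) hs le_rfl
  have hcol : ∀ j, ∃ f : ℕ × ℕ → Fin (tVal m A), j < m →
      Set.InjOn f (A.filter (fun p => p.2 = j)) := fun j => by
    by_cases hj : j < m
    · obtain ⟨f, hf⟩ := exists_injOn_fin (A.filter (fun p : ℕ × ℕ => p.2 = j)) ht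
        (rowCount_le_tVal hj)
      exact ⟨f, fun _ => hf⟩
    · exact ⟨fun _ => ⟨0, ht⟩, fun h => absurd h hj⟩
  choose colLabel hcol using hcol
  have hcode : ∀ z : EuclideanSpace ℝ (Fin 2), ∃ x y : ℕ → ℕ, z ∈ bmCarpet n m A →
      (∀ i, (x i, y i) ∈ A) ∧ z 0 = digitValue n x ∧ z 1 = digitValue m y := fun z => by
    by_cases hz : z ∈ bmCarpet n m A
    · obtain ⟨x, y, h⟩ := hz
      exact ⟨x, y, fun _ => h⟩
    · exact ⟨fun _ => 0, fun _ => 0, fun h => absurd h hz⟩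
  choose x y hcode using hcode
  let label (z : EuclideanSpace ℝ (Fin 2)) :
      (Fin (4 * n + 2) × Fin (4 * m + 2)) ×
        (Fin (digitLevel m r - digitLevel m R) → Fin (sVal m A)) ×
        (Fin (digitLevel n r - digitLevel n R) → Fin (tVal m A)) :=
    ((⟨digitPrefix n (x z) (digitLevel n R) % (4 * n + 2), Nat.mod_lt _ (by omega)⟩,
      ⟨digitPrefix m (y z) (digitLevel m R) % (4 * m + 2), Nat.mod_lt _ (by omega)⟩),
      fun i => rowLabel (y z (digitLevel m R + i)),
      fun i => colLabel (y z (digitLevel n R + i))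
        (x z (digitLevel n R + i), y z (digitLevel n R + i)))
  suffices hlabel : ∀ z ∈ bmCarpet n m A ∩ Metric.ball w R,
      ∀ z' ∈ bmCarpet n m A ∩ Metric.ball w R, label z = label z' → dist z z' < r by
    obtain ⟨F, hF, hcov⟩ := exists_cover_of_label label hlabel
    exact ⟨F, by simpa using hF, hcov⟩
  rintro z ⟨hz, hzw⟩ z' ⟨hz', hzw'⟩ heq
  obtain ⟨hmem, h0, h1⟩ := hcode z hz
  obtain ⟨hmem', h0', h1'⟩ := hcode z' hz'
  simp only [label, Prod.mk.injEq, Fin.mk.injEq] at heq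
  obtain ⟨⟨hX, hY⟩, hrows, hcols⟩ := heq
  have hx i := (hAsub _ (hmem i)).1
  have hy i := (hAsub _ (hmem i)).2
  have hx' i := (hAsub _ (hmem' i)).1
  have hy' i := (hAsub _ (hmem' i)).2
  have hdist : dist z' z < 2 * R := by
    have := dist_triangle_right z' z w
    rw [Metric.mem_ball] at hzw hzw'
    linarith
  have hyR := digitPrefix_inj hy hy' (digitPrefix_eq_of_mod_eq hm hy hy' hR
    (by rw [← h1, ← h1']; exact (abs_coord_sub_le_dist z' z 1).trans_lt hdist) hY)
  have hxR := digitPrefix_inj hx hx' (digitPrefix_eq_of_mod_eq hn hx hx' hR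
    (by rw [← h0, ← h0']; exact (abs_coord_sub_le_dist z' z 0).trans_lt hdist) hX)
  have hyr : ∀ i < digitLevel m r, y z i = y z' i := fun i hi => by
    by_cases hiR : i < digitLevel m R
    · exact hyR i hiR
    · have h := congrFun hrows ⟨i - digitLevel m R, by omega⟩
      simp only [show digitLevel m R + (i - digitLevel m R) = i by omega] at h
      refine hrow ?_ ?_ h
      · simpa [hy i] using (Nat.one_le_iff_ne_zero.1 (one_le_rowCount (hmem i)))
      · simpa [hy' i] using (Nat.one_le_iff_ne_zero.1 (one_le_rowCount (hmem' i)))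
  have hxr : ∀ i < digitLevel n r, x z i = x z' i := fun i hi => by
    by_cases hiR : i < digitLevel n R
    · exact hxR i hiR
    · have h := congrFun hcols ⟨i - digitLevel n R, by omega⟩
      have hyi := hyr i (hi.trans_le (digitLevel_le_of_base_le hm hmn.le r))
      simp only [show digitLevel n R + (i - digitLevel n R) = i by omega, ← hyi] at h
      have hmi := hmem' i
      rw [← hyi] at hmi
      exact congrArg Prod.fst (hcol _ (hy i) (by simpa using hmem i) (by simpa using hmi) h)
  refine dist_lt_of_abs_coord_le hr fun i => ?_
  fin_cases i
  · simpa [h0, h0'] using abs_digitValue_sub_le_half hn hx hx' hr hxr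
  · simpa [h1, h1'] using abs_digitValue_sub_le_half hm hy hy' hr hyr

/-- For `n > m ≥ 2` and non-empty `A ⊆ {0,…,n−1} × {0,…,m−1}`, the
Assouad dimension of the Bedford–McMullen carpet `S(A)` is at most `log_m s + log_n t`. -/
theorem bm_assouadDim_le (n m : ℕ) (hm : 2 ≤ m) (hmn : m < n)
    (A : Finset (ℕ × ℕ)) (hA : A.Nonempty)
    (hAsub : ∀ p ∈ A, p.1 < n ∧ p.2 < m) :
    assouadDim (bmCarpet n m A) ≤
      Real.logb m (sVal m A) + Real.logb n (tVal m A) := by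
  obtain ⟨p, hp⟩ := hA
  have hpm := (hAsub p hp).2
  have hn : 2 ≤ n := by omega
  have hs : 1 ≤ sVal m A := Finset.card_pos.2 ⟨p.2, by
    simpa [hpm] using Nat.one_le_iff_ne_zero.1 (one_le_rowCount hp)⟩
  have ht : 1 ≤ tVal m A := (one_le_rowCount hp).trans (rowCount_le_tVal hpm)
  have hα : 0 ≤ Real.logb m (sVal m A) :=
    Real.logb_nonneg (by exact_mod_cast hm) (by exact_mod_cast hs)
  have hβ : 0 ≤ Real.logb n (tVal m A) :=
    Real.logb_nonneg (by exact_mod_cast hn) (by exact_mod_cast ht)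
  refine csInf_le ⟨0, fun _ h => h.1⟩ ⟨add_nonneg hα hβ,
    (4 * n + 2) * (4 * m + 2) *
      ((m : ℝ) ^ Real.logb m (sVal m A) * (n : ℝ) ^ Real.logb n (tVal m A)), ?_, ?_⟩
  · have : 0 < m := by omega
    have : 0 < n := by omega
    positivity
  intro w _ r R hr hrR
  obtain ⟨F, hF, hcov⟩ := bmCarpet_exists_cover hm hmn hAsub (w := w) hr hrR hs ht
  refine ⟨F, ?_, hcov⟩
  have hq : 0 < R / r := div_pos (hr.trans_le hrR) hr
  have h1 := pow_le_rpow_logb hm hs (pow_digitLevel_sub_le hm hr hrR)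
  have h2 := pow_le_rpow_logb hn ht (pow_digitLevel_sub_le hn hr hrR)
  rw [Real.mul_rpow (by positivity) hq.le] at h1 h2
  calc (F.card : ℝ) ≤ (4 * n + 2) * (4 * m + 2) *
        ((sVal m A : ℝ) ^ (digitLevel m r - digitLevel m R) *
          (tVal m A : ℝ) ^ (digitLevel n r - digitLevel n R)) := by exact_mod_cast hF
    _ ≤ (4 * n + 2) * (4 * m + 2) *
        (((m : ℝ) ^ Real.logb m (sVal m A) * (R / r) ^ Real.logb m (sVal m A)) *
          ((n : ℝ) ^ Real.logb n (tVal m A) * (R / r) ^ Real.logb n (tVal m A))) := by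
        gcongr
    _ = _ := by
        rw [Real.rpow_add hq]
        ring
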